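/- Composition of an r-absolute Schmidt number channel with a unital channel: let S₁ be a function from density matrices on ℂ^d ⊗ ℂ^d to density matrices on ℂ^d ⊗ ℂ^d whose range is contained in r-ABSN, and let (K_i)_{i∈I} be a finite family of (d²)×(d²) complex matrices satisfying Σ_i K_i† K_i = I (trace preservation) and Σ_i K_i K_i† = I (unitality); define S₂(X) = Σ_i K_i X K_i†. Then for every density matrix ρ on ℂ^d ⊗ ℂ^d, S₂(S₁(ρ)) is a density matrix belonging to r-ABSN. -/

import Mathlib

open Matrix BigOperators
open scoped ComplexOrder

/-- The space of complex matrices acting on `ℂ^d ⊗ ℂ^d`. -/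
abbrev MatD (d : ℕ) := Matrix (Fin d × Fin d) (Fin d × Fin d) ℂ

/-- A density matrix on `ℂ^d ⊗ ℂ^d`: positive semidefinite with trace 1. -/
def IsDensity (d : ℕ) (ρ : MatD d) : Prop :=
  ρ.PosSemidef ∧ ρ.trace = 1

/-- `ρ` has Schmidt number at most `r`: it is a finite convex combination of rank-one
projections onto unit vectors `ψ_k` whose Schmidt rank (the rank of the associated
`d × d` matrix) is at most `r`. -/
def InSchmidt (d r : ℕ) (ρ : MatD d) : Prop :=
  ∃ (n : ℕ) (p : Fin n → ℝ) (ψ : Fin n → (Fin d × Fin d) → ℂ),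
    (∀ k, 0 ≤ p k) ∧ (∑ k, p k = 1) ∧
    (∀ k, ∑ x, Complex.normSq (ψ k x) = 1) ∧
    (∀ k, (Matrix.of (fun i j => ψ k (i, j))).rank ≤ r) ∧
    ρ = ∑ k, (p k : ℂ) • Matrix.vecMulVec (ψ k) (star (ψ k))

/-- `ρ` belongs to `r`-ABSN: it is a density matrix and `U ρ U†` has Schmidt number
at most `r` for every global unitary `U`. -/
def InABSN (d r : ℕ) (ρ : MatD d) : Prop :=
  IsDensity d ρ ∧
  ∀ U ∈ Matrix.unitaryGroup (Fin d × Fin d) ℂ, InSchmidt d r (U * ρ * star U)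

namespace Matrix

variable {n ι : Type*} [Fintype n] [DecidableEq n] [Fintype ι]

/-- The matrix of summed squared moduli of the entries of a trace-preserving unital Kraus family
is doubly stochastic. -/
lemma sum_normSq_mem_doublyStochastic {L : ι → Matrix n n ℂ}
    (htp : ∑ i, star (L i) * L i = 1) (hunital : ∑ i, L i * star (L i) = 1) :
    of (fun j k => ∑ i, Complex.normSq (L i j k)) ∈ doublyStochastic ℝ n := by
  rw [mem_doublyStochastic_iff_sum]
  refine ⟨fun j k => Finset.sum_nonneg fun i _ => Complex.normSq_nonneg _, fun j => ?_,
    fun k => ?_⟩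
  · have h := congrFun (congrFun hunital j) j
    simp only [sum_apply, mul_apply, star_apply, one_apply_eq, RCLike.star_def,
      Complex.mul_conj] at h
    rw [Finset.sum_comm] at h
    exact_mod_cast h
  · have h := congrFun (congrFun htp k) k
    simp only [sum_apply, mul_apply, star_apply, one_apply_eq, RCLike.star_def,
      ← Complex.normSq_eq_conj_mul_self] at h
    rw [Finset.sum_comm] at h
    exact_mod_cast h

lemma sum_mul_diagonal_mul_star_apply_self (L : ι → Matrix n n ℂ) (x : n → ℝ) (j : n) :
    (∑ i, L i * diagonal (fun k => (x k : ℂ)) * star (L i)) j j =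
      (((of fun j k => ∑ i, Complex.normSq (L i j k)) *ᵥ x) j : ℝ) := by
  simp only [sum_apply, mul_apply (M := _ * _), mul_diagonal, star_apply, mulVec, dotProduct, of_apply,
    Complex.ofReal_sum, Complex.ofReal_mul, Finset.sum_mul, RCLike.star_def]
  rw [Finset.sum_comm]
  refine Finset.sum_congr rfl fun k _ => Finset.sum_congr rfl fun i _ => ?_
  rw [← Complex.mul_conj]
  ring

lemma permMatrix_mem_unitaryGroup (σ : Equiv.Perm n) :
    σ.permMatrix ℂ ∈ unitaryGroup n ℂ := by
  rw [mem_unitaryGroup_iff, star_eq_conjTranspose, conjTranspose_permMatrix, ← permMatrix_mul,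
    inv_mul_cancel, permMatrix_one]

lemma permMatrix_mul_diagonal_mul_star (σ : Equiv.Perm n) (x : n → ℂ) :
    σ.permMatrix ℂ * diagonal x * star (σ.permMatrix ℂ) = diagonal (x ∘ σ) := by
  have h : σ.permMatrix ℂ * diagonal x = diagonal (x ∘ σ) * σ.permMatrix ℂ := by
    ext i j
    rw [mul_diagonal, diagonal_mul, Equiv.Perm.permMatrix, PEquiv.toMatrix_apply]
    by_cases hij : σ i = j <;> simp [hij]
  rw [h, mul_assoc, mem_unitaryGroup_iff.1 (permMatrix_mem_unitaryGroup σ), mul_one]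

/-- The image of a Hermitian matrix under a unital trace-preserving Kraus map is a convex
combination of unitary conjugates of that matrix. -/
theorem IsHermitian.exists_sum_kraus_eq_sum_unitary_conj {A : Matrix n n ℂ} (hA : A.IsHermitian)
    {K : ι → Matrix n n ℂ} (htp : ∑ i, star (K i) * K i = 1)
    (hunital : ∑ i, K i * star (K i) = 1) :
    ∃ (w : Equiv.Perm n → ℝ) (U : Equiv.Perm n → unitaryGroup n ℂ),
      (∀ σ, 0 ≤ w σ) ∧ ∑ σ, w σ = 1 ∧
      ∑ i, K i * A * star (K i) =
        ∑ σ, w σ • ((U σ : Matrix n n ℂ) * A * star (U σ : Matrix n n ℂ)) := by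
  set T := ∑ i, K i * A * star (K i) with hT
  have hTh : T.IsHermitian := by
    rw [IsHermitian, ← star_eq_conjTranspose, hT, star_sum]
    simp only [star_mul, star_star, (show star A = A from hA), mul_assoc]
  obtain ⟨V, x, hV, hAx⟩ : ∃ (V : Matrix n n ℂ) (x : n → ℝ), V ∈ unitaryGroup n ℂ ∧
      A = V * diagonal (fun k => (x k : ℂ)) * star V :=
    ⟨_, hA.eigenvalues, hA.eigenvectorUnitary.2, hA.spectral_theorem⟩
  obtain ⟨W, y, hW, hTy⟩ : ∃ (W : Matrix n n ℂ) (y : n → ℝ), W ∈ unitaryGroup n ℂ ∧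
      T = W * diagonal (fun k => (y k : ℂ)) * star W :=
    ⟨_, hTh.eigenvalues, hTh.eigenvectorUnitary.2, hTh.spectral_theorem⟩
  have hV₁ := mem_unitaryGroup_iff.1 hV
  have hV₂ := mem_unitaryGroup_iff'.1 hV
  have hW₁ := mem_unitaryGroup_iff.1 hW
  have hW₂ := mem_unitaryGroup_iff'.1 hW
  let L : ι → Matrix n n ℂ := fun i => star W * K i * V
  have hLtp : ∑ i, star (L i) * L i = 1 := by
    calc ∑ i, star (L i) * L i = ∑ i, star V * (star (K i) * K i) * V := by
          refine Finset.sum_congr rfl fun i _ => ?_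
          calc star (L i) * L i = star V * star (K i) * (W * star W) * K i * V := by
                simp only [L, star_mul, star_star, mul_assoc]
            _ = _ := by rw [hW₁]; simp only [mul_one, mul_assoc]
      _ = 1 := by rw [← Finset.sum_mul, ← Finset.mul_sum, htp, mul_one, hV₂]
  have hLun : ∑ i, L i * star (L i) = 1 := by
    calc ∑ i, L i * star (L i) = ∑ i, star W * (K i * star (K i)) * W := by
          refine Finset.sum_congr rfl fun i _ => ?_
          calc L i * star (L i) = star W * K i * (V * star V) * star (K i) * W := by
                simp only [L, star_mul, star_star, mul_assoc]
            _ = _ := by rw [hV₁]; simp only [mul_one, mul_assoc]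
      _ = 1 := by rw [← Finset.sum_mul, ← Finset.mul_sum, hunital, mul_one, hW₂]
  have hLD : ∑ i, L i * diagonal (fun k => (x k : ℂ)) * star (L i) =
      diagonal (fun k => (y k : ℂ)) := by
    calc ∑ i, L i * diagonal (fun k => (x k : ℂ)) * star (L i)
        = ∑ i, star W * (K i * A * star (K i)) * W := by
          refine Finset.sum_congr rfl fun i _ => ?_
          simp only [L, hAx, star_mul, star_star, mul_assoc]
      _ = star W * T * W := by rw [← Finset.sum_mul, ← Finset.mul_sum]
      _ = (star W * W) * diagonal (fun k => (y k : ℂ)) * (star W * W) := by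
          rw [hTy]; simp only [mul_assoc]
      _ = _ := by rw [hW₂, one_mul, mul_one]
  obtain ⟨w, hw₀, hw₁, hw⟩ :=
    exists_eq_sum_perm_of_mem_doublyStochastic (sum_normSq_mem_doublyStochastic hLtp hLun)
  have hy : ∀ j, y j = ∑ σ, w σ * x (σ j) := fun j => by
    have h := sum_mul_diagonal_mul_star_apply_self L x j
    rw [hLD, diagonal_apply_eq, ← hw, sum_mulVec] at h
    simpa [smul_mulVec, permMatrix_mulVec] using Complex.ofReal_injective h
  have hD : diagonal (fun k => (y k : ℂ)) =
      ∑ σ : Equiv.Perm n, w σ • (σ.permMatrix ℂ * diagonal (fun k => (x k : ℂ)) *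
        star (σ.permMatrix ℂ)) := by
    simp only [permMatrix_mul_diagonal_mul_star]
    ext i j
    by_cases hij : i = j
    · subst hij
      simp [sum_apply, hy]
    · simp [sum_apply, hij]
  refine ⟨w, fun σ => ⟨W * σ.permMatrix ℂ * star V,
    mul_mem (mul_mem hW (permMatrix_mem_unitaryGroup σ)) (Unitary.star_mem hV)⟩, hw₀, hw₁, ?_⟩
  rw [hTy, hD, Finset.mul_sum, Finset.sum_mul]
  refine Finset.sum_congr rfl fun σ _ => ?_
  rw [mul_smul_comm, smul_mul_assoc]
  congr 1
  calc W * (σ.permMatrix ℂ * diagonal (fun k => (x k : ℂ)) * star (σ.permMatrix ℂ)) * star W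
      = W * σ.permMatrix ℂ * (star V * V) * diagonal (fun k => (x k : ℂ)) * (star V * V) *
          star (σ.permMatrix ℂ) * star W := by
        rw [hV₂]; simp only [mul_one, mul_assoc]
    _ = _ := by rw [hAx]; simp only [star_mul, star_star, mul_assoc]

end Matrix

/-- The matrices of Schmidt number at most `r` form the convex hull of the projections onto unit
vectors of Schmidt rank at most `r`. -/
lemma setOf_inSchmidt_eq_convexHull (d r : ℕ) :
    {ρ | InSchmidt d r ρ} = convexHull ℝ {ρ : MatD d | ∃ ψ : Fin d × Fin d → ℂ,
      ∑ x, Complex.normSq (ψ x) = 1 ∧ (Matrix.of (fun i j => ψ (i, j))).rank ≤ r ∧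
      ρ = Matrix.vecMulVec ψ (star ψ)} := by
  ext ρ
  constructor
  · rintro ⟨n, p, ψ, hp₀, hp₁, hψ, hr, rfl⟩
    exact mem_convexHull_of_exists_fintype p (fun k => Matrix.vecMulVec (ψ k) (star (ψ k)))
      hp₀ hp₁ (fun k => ⟨ψ k, hψ k, hr k, rfl⟩) (by simp only [Complex.coe_smul])
  · intro h
    obtain ⟨κ, _, p, z, hp₀, hp₁, hz, rfl⟩ := mem_convexHull_iff_exists_fintype.1 h
    choose ψ hψ hr hz using hz
    let e := (Fintype.equivFin κ).symm
    refine ⟨Fintype.card κ, p ∘ e, ψ ∘ e, fun k => hp₀ _, ?_, fun k => hψ _, fun k => hr _, ?_⟩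
    · rw [← hp₁]
      exact Equiv.sum_comp e p
    · simp only [Complex.coe_smul, Function.comp_apply, ← hz]
      exact (Equiv.sum_comp e fun k => p k • z k).symm

lemma convex_setOf_inSchmidt (d r : ℕ) : Convex ℝ {ρ | InSchmidt d r ρ} := by
  rw [setOf_inSchmidt_eq_convexHull]
  exact convex_convexHull ℝ _

lemma IsDensity.sum_kraus {d : ℕ} {ι : Type*} [Fintype ι] {K : ι → MatD d} {ρ : MatD d}
    (hρ : IsDensity d ρ) (htp : ∑ i, star (K i) * K i = 1) :
    IsDensity d (∑ i, K i * ρ * star (K i)) := by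
  refine ⟨Matrix.posSemidef_sum _ fun i _ => hρ.1.mul_mul_conjTranspose_same (K i), ?_⟩
  rw [Matrix.trace_sum]
  simp_rw [Matrix.trace_mul_cycle (K _) ρ]
  rw [← Matrix.trace_sum, ← Finset.sum_mul, htp, one_mul, hρ.2]

/-- The set `r`-ABSN is invariant under unital trace-preserving Kraus maps. -/
lemma InABSN.sum_kraus {d r : ℕ} {ι : Type*} [Fintype ι] {K : ι → MatD d} {ρ : MatD d}
    (hρ : InABSN d r ρ) (htp : ∑ i, star (K i) * K i = 1)
    (hunital : ∑ i, K i * star (K i) = 1) :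
    InABSN d r (∑ i, K i * ρ * star (K i)) := by
  refine ⟨hρ.1.sum_kraus htp, fun U hU => ?_⟩
  obtain ⟨w, V, hw₀, hw₁, h⟩ :=
    hρ.1.1.isHermitian.exists_sum_kraus_eq_sum_unitary_conj htp hunital
  rw [h, Finset.mul_sum, Finset.sum_mul]
  simp only [mul_smul_comm, smul_mul_assoc]
  refine (convex_setOf_inSchmidt d r).sum_mem (fun σ _ => hw₀ σ) hw₁ fun σ _ => ?_
  have := hρ.2 (U * V σ) (mul_mem hU (V σ).2)
  simpa only [star_mul, mul_assoc, Set.mem_ofPred_eq] using this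

/-- composing an `r`-absolute Schmidt number channel `S₁` with a
unital (trace-preserving) Kraus channel `S₂(X) = Σ_i K_i X K_i†` keeps every
output inside `r`-ABSN. -/
theorem absn_channel_comp_unital (d r : ℕ) (hd : 1 ≤ d) (hr : 1 ≤ r)
    (S₁ : MatD d → MatD d) (hS₁ : ∀ ρ, IsDensity d ρ → InABSN d r (S₁ ρ))
    (ι : Type) [Fintype ι] (K : ι → MatD d)
    (htp : ∑ i, star (K i) * K i = 1)
    (hunital : ∑ i, K i * star (K i) = 1)
    (ρ : MatD d) (hρ : IsDensity d ρ) :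
    IsDensity d (∑ i, K i * S₁ ρ * star (K i)) ∧
    InABSN d r (∑ i, K i * S₁ ρ * star (K i)) := by
  have h := (hS₁ ρ hρ).sum_kraus htp hunital
  exact ⟨h.1, h⟩
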